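/- If M and N are h-equivalent left R-modules, then their endomorphism rings End_R(M) and End_R(N) are Morita equivalent rings; in particular, the centers of End_R(M) and End_R(N) are isomorphic. -/

import Mathlib

universe u

open CategoryTheory

section CompSum

variable {R M₁ M₂ M₃ ι : Type*} [Ring R] [AddCommGroup M₁] [AddCommGroup M₂] [AddCommGroup M₃]
  [Module R M₁] [Module R M₂] [Module R M₃] [Fintype ι]

lemma LinearMap.comp_univ_sum (q : M₂ →ₗ[R] M₃) (f : ι → (M₁ →ₗ[R] M₂)) :
    q ∘ₗ ∑ i, f i = ∑ i, q ∘ₗ f i := by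
  ext x
  simp [LinearMap.sum_apply]

lemma LinearMap.univ_sum_comp (f : ι → (M₂ →ₗ[R] M₃)) (q : M₁ →ₗ[R] M₂) :
    (∑ i, f i) ∘ₗ q = ∑ i, f i ∘ₗ q := by
  ext x
  simp [LinearMap.sum_apply]

end CompSum

section EndomorphismModules

variable (R M N : Type u) [Ring R] [AddCommGroup M] [AddCommGroup N] [Module R M] [Module R N]

/-- Given a module `X` over `End_R(M)`, the group of `End_R(M)`-linear maps
`Hom_R(N, M) → X`, viewed as a left `End_R(N)`-module through precomposition. -/
def EndHomModule (X : Type u) [AddCommGroup X] [Module (Module.End R M) X] : Type u :=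
  (N →ₗ[R] M) →ₗ[Module.End R M] X

namespace EndHomModule

variable {R M N}
variable {X Y : Type u} [AddCommGroup X] [Module (Module.End R M) X]
  [AddCommGroup Y] [Module (Module.End R M) Y]

instance : AddCommGroup (EndHomModule R M N X) :=
  inferInstanceAs (AddCommGroup ((N →ₗ[R] M) →ₗ[Module.End R M] X))

instance : FunLike (EndHomModule R M N X) (N →ₗ[R] M) X :=
  inferInstanceAs (FunLike ((N →ₗ[R] M) →ₗ[Module.End R M] X) _ _)

instance : LinearMapClass (EndHomModule R M N X) (Module.End R M) (N →ₗ[R] M) X :=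
  inferInstanceAs (LinearMapClass ((N →ₗ[R] M) →ₗ[Module.End R M] X) _ _ _)

@[ext]
lemma ext {φ ψ : EndHomModule R M N X} (h : ∀ p, φ p = ψ p) : φ = ψ :=
  DFunLike.ext _ _ h

@[simp]
lemma add_apply (φ ψ : EndHomModule R M N X) (p : N →ₗ[R] M) : (φ + ψ) p = φ p + ψ p := rfl

@[simp]
lemma zero_apply (p : N →ₗ[R] M) : (0 : EndHomModule R M N X) p = 0 := rfl

lemma map_comp (φ : EndHomModule R M N X) (s : Module.End R M) (p : N →ₗ[R] M) :
    φ (s ∘ₗ p) = s • φ p :=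
  map_smul φ s p

/-- Precomposition by an endomorphism of `N`. -/
instance : SMul (Module.End R N) (EndHomModule R M N X) where
  smul t φ :=
    { toFun := fun p => φ (p ∘ₗ t)
      map_add' := fun p q => by rw [LinearMap.add_comp, map_add]
      map_smul' := fun s p => map_comp φ s (p ∘ₗ t) }

@[simp]
lemma smul_apply (t : Module.End R N) (φ : EndHomModule R M N X) (p : N →ₗ[R] M) :
    (t • φ) p = φ (p ∘ₗ t) := rfl

instance : Module (Module.End R N) (EndHomModule R M N X) where
  one_smul _ := rfl
  mul_smul _ _ _ := rfl
  smul_zero _ := rfl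
  smul_add _ _ _ := rfl
  add_smul s t φ := by ext p; simp [LinearMap.comp_add]
  zero_smul φ := by ext p; simp

/-- Postcomposition with an `End_R(M)`-linear map. -/
def map (f : X →ₗ[Module.End R M] Y) :
    EndHomModule R M N X →ₗ[Module.End R N] EndHomModule R M N Y where
  toFun φ := f ∘ₗ (show (N →ₗ[R] M) →ₗ[Module.End R M] X from φ)
  map_add' φ ψ := by
    ext p
    exact map_add f (φ p) (ψ p)
  map_smul' _ _ := rfl

variable (R M N X) in
/-- The evaluation map sending `x` to `q ↦ p ↦ (p ∘ q) • x`. -/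
def eval : X →ₗ[Module.End R M] EndHomModule R N M (EndHomModule R M N X) where
  toFun x :=
    { toFun := fun q =>
        { toFun := fun p => (show Module.End R M from p ∘ₗ q) • x
          map_add' := fun p p' => by rw [LinearMap.add_comp]; exact add_smul _ _ x
          map_smul' := fun s p => mul_smul s (show Module.End R M from p ∘ₗ q) x }
      map_add' := fun q q' => by
        ext p
        exact (congrArg (fun s : Module.End R M => s • x) (LinearMap.comp_add q q' p)).trans
          (add_smul _ _ x)
      map_smul' := fun _ _ => rfl }
  map_add' x y := by
    ext q p
    exact smul_add _ x y
  map_smul' s x := by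
    ext q p
    exact (mul_smul (show Module.End R M from p ∘ₗ q) s x).symm

@[simp]
lemma eval_apply (x : X) (q : M →ₗ[R] N) (p : N →ₗ[R] M) :
    eval R M N X x q p = (show Module.End R M from p ∘ₗ q) • x := rfl

lemma eval_bijective {ι : Type*} [Fintype ι] (f : ι → (N →ₗ[R] M)) (g : ι → (M →ₗ[R] N))
    (h : ∑ i, f i ∘ₗ g i = LinearMap.id) : Function.Bijective (eval R M N X) := by
  refine Function.bijective_iff_has_inverse.mpr ⟨fun Φ => ∑ i, Φ (g i) (f i), fun x => ?_,
    fun Φ => ?_⟩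
  · simp only [eval_apply]
    rw [← Finset.sum_smul]
    exact (congrArg (fun s : Module.End R M => s • x) h).trans (one_smul _ x)
  · ext q p
    rw [eval_apply, Finset.smul_sum]
    have hq : ∑ i, (show Module.End R N from q ∘ₗ f i) • g i = q := by
      have := congrArg (fun s => q ∘ₗ s) h
      rw [LinearMap.comp_univ_sum] at this
      exact this
    have key (i : ι) : (show Module.End R M from p ∘ₗ q) • Φ (g i) (f i) =
        Φ ((show Module.End R N from q ∘ₗ f i) • g i) p := by
      rw [map_smul, smul_apply]
      exact (map_comp (Φ (g i)) (p ∘ₗ q) (f i)).symm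
    let evp : EndHomModule R M N X →+ X :=
      { toFun := fun φ => φ p, map_zero' := rfl, map_add' := fun _ _ => rfl }
    calc _ = ∑ i, evp (Φ ((show Module.End R N from q ∘ₗ f i) • g i)) :=
          Finset.sum_congr rfl fun i _ => key i
      _ = Φ q p := by rw [← map_sum, ← map_sum, hq]; rfl

variable (R M N) in
/-- The functor `X ↦ Hom_{End_R(M)}(Hom_R(N, M), X)`. -/
def functor : ModuleCat.{u} (Module.End R M) ⥤ ModuleCat.{u} (Module.End R N) where
  obj X := ModuleCat.of _ (EndHomModule R M N X)
  map f := ModuleCat.ofHom (map f.hom)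

/-- The evaluation map as a natural isomorphism, when `M` is a direct summand of a finite
direct sum of copies of `N`. -/
noncomputable def evalIso {ι : Type*} [Fintype ι] (f : ι → (N →ₗ[R] M)) (g : ι → (M →ₗ[R] N))
    (h : ∑ i, f i ∘ₗ g i = LinearMap.id) :
    𝟭 (ModuleCat.{u} (Module.End R M)) ≅ functor R M N ⋙ functor R N M :=
  NatIso.ofComponents
    (fun X => (LinearEquiv.ofBijective (eval R M N X) (eval_bijective f g h)).toModuleIso)
    (fun {X Y} k => by
      refine ModuleCat.hom_ext (LinearMap.ext fun x => ?_)
      refine EndHomModule.ext fun q => EndHomModule.ext fun p => ?_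
      exact (map_smul k.hom (show Module.End R M from p ∘ₗ q) x).symm)

end EndHomModule

end EndomorphismModules

section Center

variable {R M N : Type*} [Ring R] [AddCommGroup M] [AddCommGroup N] [Module R M] [Module R N]
variable {ι κ : Type*} [Fintype ι] [Fintype κ]

/-- The endomorphism `∑ i, f i ∘ z ∘ g i` of `N` transported from an endomorphism `z` of `M`. -/
def transferEnd (f : ι → (M →ₗ[R] N)) (g : ι → (N →ₗ[R] M)) (z : Module.End R M) :
    Module.End R N :=
  ∑ i, f i ∘ₗ z ∘ₗ g i

lemma transferEnd_comp {f : ι → (M →ₗ[R] N)} {g : ι → (N →ₗ[R] M)}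
    (h : ∑ i, f i ∘ₗ g i = LinearMap.id) {z : Module.End R M}
    (hz : z ∈ Subring.center (Module.End R M)) (q : M →ₗ[R] N) :
    transferEnd f g z ∘ₗ q = q ∘ₗ z := by
  have hc (i : ι) : (f i ∘ₗ z ∘ₗ g i) ∘ₗ q = (f i ∘ₗ g i) ∘ₗ (q ∘ₗ z) := by
    have := Subring.mem_center_iff.mp hz (g i ∘ₗ q)
    exact congrArg (fun s => f i ∘ₗ s) this.symm
  rw [transferEnd, LinearMap.univ_sum_comp, Finset.sum_congr rfl fun i _ => hc i,
    ← LinearMap.univ_sum_comp, h, LinearMap.id_comp]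

lemma transferEnd_mem_center {f : ι → (M →ₗ[R] N)} {g : ι → (N →ₗ[R] M)}
    (h : ∑ i, f i ∘ₗ g i = LinearMap.id) {z : Module.End R M}
    (hz : z ∈ Subring.center (Module.End R M)) :
    transferEnd f g z ∈ Subring.center (Module.End R N) := by
  refine Subring.mem_center_iff.mpr fun t => ?_
  have hc (i : ι) : t ∘ₗ (f i ∘ₗ z ∘ₗ g i) = (transferEnd f g z ∘ₗ t) ∘ₗ (f i ∘ₗ g i) :=
    congrArg (fun s => s ∘ₗ g i) (transferEnd_comp h hz (t ∘ₗ f i)).symm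
  calc t * transferEnd f g z = ∑ i, t ∘ₗ (f i ∘ₗ z ∘ₗ g i) := LinearMap.comp_univ_sum ..
    _ = (transferEnd f g z ∘ₗ t) ∘ₗ ∑ i, f i ∘ₗ g i := by
      rw [LinearMap.comp_univ_sum]; exact Finset.sum_congr rfl fun i _ => hc i
    _ = transferEnd f g z * t := by rw [h]; rfl

lemma transferEnd_mul {f : ι → (M →ₗ[R] N)} {g : ι → (N →ₗ[R] M)}
    (h : ∑ i, f i ∘ₗ g i = LinearMap.id) {z : Module.End R M}
    (hz : z ∈ Subring.center (Module.End R M)) (w : Module.End R M) :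
    transferEnd f g (z * w) = transferEnd f g z * transferEnd f g w := by
  have hc (i : ι) : f i ∘ₗ (z * w) ∘ₗ g i = transferEnd f g z ∘ₗ (f i ∘ₗ w ∘ₗ g i) :=
    congrArg (fun s => s ∘ₗ (w ∘ₗ g i)) (transferEnd_comp h hz (f i)).symm
  exact (Finset.sum_congr rfl fun i _ => hc i).trans (LinearMap.comp_univ_sum ..).symm

lemma transferEnd_add (f : ι → (M →ₗ[R] N)) (g : ι → (N →ₗ[R] M)) (z w : Module.End R M) :
    transferEnd f g (z + w) = transferEnd f g z + transferEnd f g w := by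
  simp [transferEnd, LinearMap.add_comp, LinearMap.comp_add, Finset.sum_add_distrib]

lemma transferEnd_transferEnd {f : ι → (M →ₗ[R] N)} {g : ι → (N →ₗ[R] M)}
    (h : ∑ i, f i ∘ₗ g i = LinearMap.id) {f' : κ → (N →ₗ[R] M)} {g' : κ → (M →ₗ[R] N)}
    (h' : ∑ i, f' i ∘ₗ g' i = LinearMap.id) {z : Module.End R M}
    (hz : z ∈ Subring.center (Module.End R M)) :
    transferEnd f' g' (transferEnd f g z) = z := by
  have hc (i : κ) : f' i ∘ₗ transferEnd f g z ∘ₗ g' i = (f' i ∘ₗ g' i) ∘ₗ z :=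
    congrArg (fun s => f' i ∘ₗ s) (transferEnd_comp h hz (g' i))
  rw [transferEnd, Finset.sum_congr rfl fun i _ => hc i, ← LinearMap.univ_sum_comp, h',
    LinearMap.id_comp]

/-- The centers of the endomorphism rings of h-equivalent modules are isomorphic. -/
def centerEndEquiv {f : ι → (M →ₗ[R] N)} {g : ι → (N →ₗ[R] M)}
    (h : ∑ i, f i ∘ₗ g i = LinearMap.id) {f' : κ → (N →ₗ[R] M)} {g' : κ → (M →ₗ[R] N)}
    (h' : ∑ i, f' i ∘ₗ g' i = LinearMap.id) :
    Subring.center (Module.End R M) ≃+* Subring.center (Module.End R N) where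
  toFun z := ⟨transferEnd f g z, transferEnd_mem_center h z.2⟩
  invFun w := ⟨transferEnd f' g' w, transferEnd_mem_center h' w.2⟩
  left_inv z := Subtype.ext (transferEnd_transferEnd h h' z.2)
  right_inv w := Subtype.ext (transferEnd_transferEnd h' h w.2)
  map_mul' z w := Subtype.ext (transferEnd_mul h z.2 w)
  map_add' z w := Subtype.ext (transferEnd_add f g z w)

end Center

/-- If `M` and `N` are h-equivalent left `R`-modules (each is a direct summand of a finite
direct sum of copies of the other), then `End_R(M)` and `End_R(N)` are Morita equivalent
rings (their module categories are equivalent); in particular the centers of `End_R(M)`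
and `End_R(N)` are isomorphic rings. -/
theorem stmt0 (R : Type u) [Ring R] (M N : Type u) [AddCommGroup M] [AddCommGroup N]
    [Module R M] [Module R N]
    (h₁ : ∃ r : ℕ, 0 < r ∧ ∃ (f : Fin r → (M →ₗ[R] N)) (g : Fin r → (N →ₗ[R] M)),
      ∑ i, (f i) ∘ₗ (g i) = LinearMap.id)
    (h₂ : ∃ s : ℕ, 0 < s ∧ ∃ (f : Fin s → (N →ₗ[R] M)) (g : Fin s → (M →ₗ[R] N)),
      ∑ i, (f i) ∘ₗ (g i) = LinearMap.id) :
    Nonempty (ModuleCat.{u} (Module.End R M) ≌ ModuleCat.{u} (Module.End R N)) ∧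
    Nonempty (Subring.center (Module.End R M) ≃+* Subring.center (Module.End R N)) := by
  obtain ⟨r, -, f, g, h⟩ := h₁
  obtain ⟨s, -, f', g', h'⟩ := h₂
  exact ⟨⟨CategoryTheory.Equivalence.mk (EndHomModule.functor R M N) (EndHomModule.functor R N M)
    (EndHomModule.evalIso f' g' h') (EndHomModule.evalIso f g h).symm⟩, ⟨centerEndEquiv h h'⟩⟩
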